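/- arXiv:2101.09867 — 2 statements merged into one kernel-verified Lean document; each statement's English description precedes it below -/
import Mathlib

section
/- Let M ∈ C^∞([0,∞), ℝ), let N ≥ 2 be an integer, and let η > 0. Let w_η be the unique C¹ solution on [0,∞) of w′(t) + η w(t) + ∫_0^t M(t-s) w(s) ds = 0 with w(0) = 1. Then for every t ≥ 0, w_η(t) = e^{-η t} ( 1 + ∑_{l=0}^{N-1} p_l(t) η^{-l-1} ) + ∑_{l=0}^{N-1} h_l(t) η^{-l-1} + R_N(t,η) η^{-N-1}, where R_N(t,τ) := ∫_0^t τ e^{-τ s} ∂_s^N K_M(t,s) ds. -/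
open Set MeasureTheory

/-- Convolution on `[0,∞)` (via signed interval integral): `(f*g)(t) = ∫_0^t f(t-s) g(s) ds`. -/
noncomputable def conv (f g : ℝ → ℝ) : ℝ → ℝ :=
  fun t => ∫ s in (0:ℝ)..t, f (t - s) * g s

/-- `j`-fold convolution power of `M`, with the conventions `M^{*0} = 0` and `M^{*1} = M`. -/
noncomputable def convPow (M : ℝ → ℝ) : ℕ → ℝ → ℝ
  | 0 => fun _ => 0
  | 1 => M
  | (j+2) => conv M (convPow M (j+1))

/-- The norm `‖f‖_{C^k([0,t])} = ∑_{l=0}^k max_{0 ≤ τ ≤ t} |f^{(l)}(τ)|`,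
derivatives taken within `[0,∞)`. -/
noncomputable def CkNorm (k : ℕ) (t : ℝ) (f : ℝ → ℝ) : ℝ :=
  ∑ l ∈ Finset.range (k+1), ⨆ τ : Set.Icc (0:ℝ) t, |iteratedDerivWithin l f (Set.Ici 0) τ|

/-- The flow kernel `K_M(t,s) = ∑_{j≥1} ((-s)^j / j!) M^{*j}(t-s)`. -/
noncomputable def KM (M : ℝ → ℝ) (t s : ℝ) : ℝ :=
  ∑' j : ℕ, ((-s) ^ j / (j.factorial : ℝ)) * convPow M j (t - s)

/-- The coefficient `h_l(t) = (-1)^l ∑_{j=0}^l C(l, l-j) (d^{l-j}/dt^{l-j} M^{*j})(t)`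
(derivatives taken within `[0,∞)`; recall the convention `M^{*0} = 0`). -/
noncomputable def hcoef (M : ℝ → ℝ) (l : ℕ) (t : ℝ) : ℝ :=
  (-1 : ℝ) ^ l * ∑ j ∈ Finset.range (l + 1),
    (l.choose (l - j) : ℝ) * iteratedDerivWithin (l - j) (convPow M j) (Set.Ici 0) t

/-- The coefficient
`p_l(t) = −h_l(0) + (-1)^{l+1} ∑_{(m,j)} C(l, l-j+m) ((d^{l-j+m}/dt^{l-j+m}) M^{*j})(0) (-t)^m/m!`,
where the sum runs over pairs of positive integers `(m,j)` with `2j − l − 1 ≤ m ≤ j`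
(equivalently `2j ≤ m + l + 1`; all such pairs satisfy `m ≤ j ≤ l + 1`, and the exponent
`l - j + m` is the natural number `l + m - j ≥ 0`). -/
noncomputable def pcoef (M : ℝ → ℝ) (l : ℕ) (t : ℝ) : ℝ :=
  -hcoef M l 0 + (-1 : ℝ) ^ (l + 1) *
    ∑ j ∈ Finset.Icc 1 (l + 1), ∑ m ∈ Finset.Icc 1 j,
      if 2 * j ≤ m + l + 1 then
        (l.choose (l + m - j) : ℝ) *
          iteratedDerivWithin (l + m - j) (convPow M j) (Set.Ici 0) 0 *
          ((-t) ^ m / (m.factorial : ℝ))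
      else 0

/-- The remainder kernel `R_N(t,τ) = ∫_0^t τ e^{-τs} ∂_s^N K_M(t,s) ds`,
the `s`-derivative of `K_M(t,·)` being taken within its domain `(-∞, t]`. -/
noncomputable def RNrem (M : ℝ → ℝ) (N : ℕ) (t τ : ℝ) : ℝ :=
  ∫ s in (0:ℝ)..t,
    τ * Real.exp (-τ * s) * iteratedDerivWithin N (fun s' => KM M t s') (Set.Iic t) s

/-- `w` is a `C¹` solution on `[0,∞)` of the memory ODE
`w′(t) + η w(t) + ∫_0^t M(t-s) w(s) ds = 0` with `w(0) = 1`
(the derivative at `0` being taken within `[0,∞)`). -/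
noncomputable def IsMemorySol (M : ℝ → ℝ) (η : ℝ) (w : ℝ → ℝ) : Prop :=
  ContDiffOn ℝ 1 w (Set.Ici 0) ∧ w 0 = 1 ∧
    ∀ t : ℝ, 0 ≤ t →
      derivWithin w (Set.Ici 0) t + η * w t + (∫ s in (0:ℝ)..t, M (t - s) * w s) = 0

/-- A function continuous on `[0,∞)` becomes continuous on the line after composition with
`max · 0`. -/
lemma ContinuousOn.comp_max_zero {g : ℝ → ℝ} (hg : ContinuousOn g (Ici 0)) :
    Continuous fun x => g (max x 0) :=
  hg.comp_continuous (by fun_prop) fun x => le_max_right x 0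

lemma conv_intervalIntegrable {f g : ℝ → ℝ} (hf : ContinuousOn f (Ici 0))
    (hg : ContinuousOn g (Ici 0)) {t : ℝ} (ht : 0 ≤ t) :
    IntervalIntegrable (fun s => f (t - s) * g s) volume 0 t := by
  apply ContinuousOn.intervalIntegrable
  rw [uIcc_of_le ht]
  refine ContinuousOn.mul (hf.comp (by fun_prop) ?_) (hg.mono fun s hs => hs.1)
  intro s hs
  simpa using hs.2

lemma conv_comm (f g : ℝ → ℝ) : conv f g = conv g f := by
  funext t
  unfold conv
  have h := intervalIntegral.integral_comp_sub_left (a := 0) (b := t)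
    (fun s => f (t - s) * g s) t
  simp only [sub_sub_cancel, sub_zero, sub_self] at h
  rw [← h]
  simp only [mul_comm]

/-- Differentiation of a convolution on `[0,∞)`, with the derivative falling on the first factor. -/
lemma hasDerivWithinAt_conv {f f' g : ℝ → ℝ}
    (hf : ∀ x, 0 ≤ x → HasDerivWithinAt f (f' x) (Ici 0) x)
    (hf' : ContinuousOn f' (Ici 0)) (hg : ContinuousOn g (Ici 0)) {t : ℝ} (ht : 0 ≤ t) :
    HasDerivWithinAt (conv f g) (f 0 * g t + conv f' g t) (Ici 0) t := by
  have hfc : ContinuousOn f (Ici 0) := fun x hx => (hf x hx).continuousWithinAt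
  set φ : ℝ → ℝ := fun x => f (max x 0) - f 0 with hφ
  set G : ℝ → ℝ := fun x => g (max x 0) with hG
  have hφc : Continuous φ := hfc.comp_max_zero.sub continuous_const
  have hGc : Continuous G := hg.comp_max_zero
  have hφneg : ∀ x ≤ 0, φ x = 0 := fun x hx => by simp [hφ, max_eq_right hx]
  have hrepr : ∀ x ∈ Icc 0 (t + 1),
      conv f g x = f 0 * (∫ s in (0:ℝ)..x, G s) + ∫ s in (0:ℝ)..(t + 1), φ (x - s) * G s := by
    intro x hx
    have hi : ∀ a b, IntervalIntegrable (fun s => φ (x - s) * G s) volume a b := fun a b =>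
      Continuous.intervalIntegrable (by fun_prop) _ _
    rw [← intervalIntegral.integral_add_adjacent_intervals (hi 0 x) (hi x (t + 1))]
    have h0 : (∫ s in x..(t + 1), φ (x - s) * G s) = 0 := by
      rw [← intervalIntegral.integral_zero (a := x) (b := t + 1) (μ := volume)]
      apply intervalIntegral.integral_congr
      intro s hs
      rw [uIcc_of_le hx.2] at hs
      simp [hφneg (x - s) (by linarith [hs.1])]
    rw [h0, add_zero, ← intervalIntegral.integral_const_mul, ← intervalIntegral.integral_add
      (Continuous.intervalIntegrable (by fun_prop) _ _) (hi 0 x)]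
    apply intervalIntegral.integral_congr
    intro s hs
    rw [uIcc_of_le hx.1] at hs
    have h1 : max (x - s) 0 = x - s := max_eq_left (by linarith [hs.2])
    have h2 : max s 0 = s := max_eq_left hs.1
    simp only [hφ, hG, h1, h2]
    ring
  have hd1 : HasDerivAt (fun x => f 0 * ∫ s in (0:ℝ)..x, G s) (f 0 * g t) t := by
    have := (hGc.integral_hasStrictDerivAt 0 t).hasDerivAt.const_mul (f 0)
    simpa [hG, max_eq_left ht] using this
  obtain ⟨B, hB⟩ : ∃ B, ∀ x ∈ Icc 0 (t + 1), ‖f' x‖ ≤ B :=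
    isCompact_Icc.exists_bound_of_continuousOn (hf'.mono fun x hx => hx.1)
  obtain ⟨Bg, hBg⟩ : ∃ B, ∀ x ∈ Icc 0 (t + 1), ‖G x‖ ≤ B :=
    isCompact_Icc.exists_bound_of_continuousOn hGc.continuousOn
  have hB0 : 0 ≤ B := (norm_nonneg _).trans (hB 0 ⟨le_rfl, by linarith⟩)
  have hBg0 : 0 ≤ Bg := (norm_nonneg _).trans (hBg 0 ⟨le_rfl, by linarith⟩)
  have hφlip : ∀ x ≤ t + 1, ∀ y ≤ t + 1, |φ x - φ y| ≤ B * |x - y| := by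
    intro x hx y hy
    have h := (convex_Icc 0 (t + 1)).norm_image_sub_le_of_norm_hasDerivWithin_le
      (fun z hz => (hf z hz.1).mono fun u hu => hu.1) hB
      (x := max y 0) (y := max x 0) ⟨le_max_right _ _, max_le hy (by linarith)⟩
      ⟨le_max_right _ _, max_le hx (by linarith)⟩
    simp only [Real.norm_eq_abs] at h
    calc |φ x - φ y| = |f (max x 0) - f (max y 0)| := by simp [hφ]
      _ ≤ B * |max x 0 - max y 0| := h
      _ ≤ B * |x - y| := by
        exact mul_le_mul_of_nonneg_left (abs_max_sub_max_le_abs x y 0) hB0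
  have hd2 := (intervalIntegral.hasDerivAt_integral_of_dominated_loc_of_lip
    (μ := volume) (a := 0) (b := t + 1) (x₀ := t) (s := Ioo (t - 1) (t + 1))
    (F := fun x s => φ (x - s) * G s)
    (F' := (Iio t).indicator fun s => f' (max (t - s) 0) * G s)
    (bound := fun _ => B * Bg)
    (Ioo_mem_nhds (by linarith) (by linarith))
    (Filter.Eventually.of_forall fun x => Continuous.aestronglyMeasurable (by fun_prop))
    (Continuous.intervalIntegrable (by fun_prop) _ _)
    (by
      refine (Continuous.aestronglyMeasurable ?_).indicator measurableSet_Iio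
      have := hf'.comp_max_zero
      exact (this.comp (continuous_const.sub continuous_id)).mul hGc)
    (by
      refine Filter.Eventually.of_forall fun s hs => ?_
      rw [uIoc_of_le (by linarith)] at hs
      apply LipschitzOnWith.of_dist_le_mul
      intro x hx y hy
      simp only [Real.dist_eq, Real.coe_nnabs]
      rw [abs_of_nonneg (mul_nonneg hB0 hBg0), ← sub_mul, abs_mul]
      have h1 := hφlip (x - s) (by linarith [hx.2, hs.1]) (y - s) (by linarith [hy.2, hs.1])
      have h2 := hBg s ⟨hs.1.le, hs.2⟩
      rw [show x - s - (y - s) = x - y by ring] at h1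
      calc |φ (x - s) - φ (y - s)| * |G s| ≤ (B * |x - y|) * Bg :=
            mul_le_mul h1 h2 (abs_nonneg _) (mul_nonneg hB0 (abs_nonneg _))
        _ = _ := by ring)
    (Continuous.intervalIntegrable (by fun_prop) _ _)
    (by
      have hne : ∀ᵐ s ∂(volume : Measure ℝ), s ≠ t := by
        simp [ae_iff]
      filter_upwards [hne] with s hst _
      rcases lt_or_gt_of_ne hst with h | h
      · have hpos : 0 < t - s := by linarith
        rw [indicator_of_mem (by exact h), max_eq_left hpos.le]
        apply HasDerivAt.mul_const
        have h1 : HasDerivAt f (f' (t - s)) (t - s) :=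
          (hf _ hpos.le).hasDerivAt (Ici_mem_nhds hpos)
        have h2 : HasDerivAt φ (f' (t - s)) (t - s) := by
          refine (h1.sub_const (f 0)).congr_of_eventuallyEq ?_
          filter_upwards [Ioi_mem_nhds hpos] with u hu
          simp [hφ, max_eq_left (le_of_lt (mem_Ioi.1 hu))]
        exact h2.comp_sub_const t s
      · rw [indicator_of_notMem (by simpa using h.le)]
        refine (hasDerivAt_const t (0:ℝ)).congr_of_eventuallyEq ?_
        filter_upwards [Iio_mem_nhds h] with u hu
        simp [hφneg (u - s) (by linarith [mem_Iio.1 hu])])).2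
  have hintegral : (∫ s in (0:ℝ)..(t + 1), (Iio t).indicator (fun s => f' (max (t - s) 0) * G s) s) =
      conv f' g t := by
    have hcont : Continuous fun s => f' (max (t - s) 0) * G s :=
      (hf'.comp_max_zero.comp (continuous_const.sub continuous_id)).mul hGc
    rw [intervalIntegral.integral_of_le (by linarith), setIntegral_indicator measurableSet_Iio]
    have hset : Ioc 0 (t + 1) ∩ Iio t = Ioo 0 t := by
      ext s
      simp only [mem_inter_iff, mem_Ioc, mem_Iio, mem_Ioo]
      constructor
      · rintro ⟨⟨h1, h2⟩, h3⟩; exact ⟨h1, h3⟩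
      · rintro ⟨h1, h2⟩; exact ⟨⟨h1, by linarith⟩, h2⟩
    rw [hset, ← integral_Ioc_eq_integral_Ioo, ← intervalIntegral.integral_of_le ht]
    apply intervalIntegral.integral_congr
    intro s hs
    rw [uIcc_of_le ht] at hs
    simp only [hG, max_eq_left hs.1, max_eq_left (sub_nonneg.2 hs.2)]
  rw [hintegral] at hd2
  refine (hd1.add hd2).hasDerivWithinAt.congr_of_eventuallyEq ?_ (hrepr t ⟨ht, by linarith⟩)
  filter_upwards [self_mem_nhdsWithin, mem_nhdsWithin_of_mem_nhds (Iio_mem_nhds (lt_add_one t))]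
    with x hx hx'
  exact hrepr x ⟨hx, le_of_lt hx'⟩

lemma iteratedDerivWithin_eq_of_hasDerivWithinAt {D : ℕ → ℝ → ℝ} {s : Set ℝ}
    (hs : UniqueDiffOn ℝ s)
    (hD : ∀ k, ∀ x ∈ s, HasDerivWithinAt (D k) (D (k + 1) x) s x) (k : ℕ) :
    ∀ x ∈ s, iteratedDerivWithin k (D 0) s x = D k x := by
  induction k with
  | zero => simp
  | succ k ih =>
    intro x hx
    rw [iteratedDerivWithin_succ, derivWithin_congr ih (ih x hx)]
    exact (hD k x hx).derivWithin (hs x hx)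

/-- The `k`-th derivative on `[0,∞)` of the convolution power `M^{*j}`, given by the recursion
`(M * g)^{(k)} = ∑_{i<k} M^{(i)}(0) g^{(k-1-i)} + M^{(k)} * g`. -/
noncomputable def convPowDeriv (M : ℝ → ℝ) : ℕ → ℕ → ℝ → ℝ
  | 0, _ => fun _ => 0
  | 1, k => iteratedDerivWithin k M (Ici 0)
  | (j+2), k => fun x =>
      ∑ i ∈ Finset.range k,
        iteratedDerivWithin i M (Ici 0) 0 * convPowDeriv M (j + 1) (k - 1 - i) x +
      conv (iteratedDerivWithin k M (Ici 0)) (convPow M (j + 1)) x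

lemma convPowDeriv_order_zero (M : ℝ → ℝ) (j : ℕ) : convPowDeriv M j 0 = convPow M j := by
  match j with
  | 0 => rfl
  | 1 => simp [convPowDeriv, convPow]
  | j + 2 => simp [convPowDeriv, convPow]

lemma hasDerivWithinAt_iteratedDerivWithin_Ici {M : ℝ → ℝ}
    (hM : ContDiffOn ℝ (⊤ : ℕ∞) M (Ici 0)) (k : ℕ) {x : ℝ} (hx : 0 ≤ x) :
    HasDerivWithinAt (iteratedDerivWithin k M (Ici 0))
      (iteratedDerivWithin (k + 1) M (Ici 0) x) (Ici 0) x := by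
  rw [iteratedDerivWithin_succ]
  refine DifferentiableWithinAt.hasDerivWithinAt ?_
  exact (hM.differentiableOn_iteratedDerivWithin (by exact_mod_cast ENat.natCast_lt_top k)
    (uniqueDiffOn_Ici 0)) x hx

lemma hasDerivWithinAt_convPowDeriv {M : ℝ → ℝ} (hM : ContDiffOn ℝ (⊤ : ℕ∞) M (Ici 0)) (j : ℕ) :
    ∀ (k : ℕ) (x : ℝ), 0 ≤ x →
      HasDerivWithinAt (convPowDeriv M j k) (convPowDeriv M j (k + 1) x) (Ici 0) x := by
  induction j using Nat.twoStepInduction with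
  | zero => exact fun k x _ => hasDerivWithinAt_const _ _ _
  | one => exact fun k x hx => hasDerivWithinAt_iteratedDerivWithin_Ici hM k hx
  | more j _ ih =>
    intro k x hx
    have hg : ContinuousOn (convPow M (j + 1)) (Ici 0) := fun y hy => by
      rw [← convPowDeriv_order_zero]; exact (ih 0 y hy).continuousWithinAt
    have h1 := hasDerivWithinAt_conv
      (fun y hy => hasDerivWithinAt_iteratedDerivWithin_Ici hM k hy)
      (fun y hy => (hasDerivWithinAt_iteratedDerivWithin_Ici hM (k + 1) hy).continuousWithinAt)
      hg hx
    have h2 := HasDerivWithinAt.fun_sum (u := Finset.range k) fun i _ =>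
      (ih (k - 1 - i) x hx).const_mul (iteratedDerivWithin i M (Ici 0) 0)
    refine (h2.add h1).congr_deriv ?_
    simp only [convPowDeriv]
    rw [Finset.sum_range_succ, ← add_assoc]
    congr 2
    · refine Finset.sum_congr rfl fun i hi => ?_
      have := Finset.mem_range.1 hi
      rw [show k + 1 - 1 - i = k - 1 - i + 1 by omega]
    · simp [convPowDeriv_order_zero]

lemma continuousOn_convPow {M : ℝ → ℝ} (hM : ContDiffOn ℝ (⊤ : ℕ∞) M (Ici 0)) (j : ℕ) :
    ContinuousOn (convPow M j) (Ici 0) := fun x hx => by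
  rw [← convPowDeriv_order_zero]
  exact (hasDerivWithinAt_convPowDeriv hM j 0 x hx).continuousWithinAt

lemma iteratedDerivWithin_convPow {M : ℝ → ℝ} (hM : ContDiffOn ℝ (⊤ : ℕ∞) M (Ici 0)) (j k : ℕ)
    {x : ℝ} (hx : 0 ≤ x) :
    iteratedDerivWithin k (convPow M j) (Ici 0) x = convPowDeriv M j k x := by
  rw [← convPowDeriv_order_zero]
  exact iteratedDerivWithin_eq_of_hasDerivWithinAt (uniqueDiffOn_Ici 0)
    (fun k x hx => hasDerivWithinAt_convPowDeriv hM j k x hx) k x hx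

/-- `M^{*j}` vanishes to order `j - 1` at the origin. -/
lemma convPowDeriv_apply_zero (M : ℝ → ℝ) (j : ℕ) :
    ∀ k, k + 2 ≤ j → convPowDeriv M j k 0 = 0 := by
  induction j using Nat.twoStepInduction with
  | zero => intro k hk; omega
  | one => intro k hk; omega
  | more j _ ih =>
    intro k hk
    simp only [convPowDeriv, conv, intervalIntegral.integral_same, add_zero]
    refine Finset.sum_eq_zero fun i hi => ?_
    have := Finset.mem_range.1 hi
    rw [ih _ (by omega), mul_zero]

/-- Geometric growth of a sequence of functions, uniformly on bounded subsets of `[0,∞)`. -/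
def GeomBounded (X : ℕ → ℝ → ℝ) : Prop :=
  ∀ T : ℝ, ∃ C A : ℝ, 0 ≤ C ∧ 0 ≤ A ∧ ∀ j, ∀ x ∈ Icc 0 T, |X j x| ≤ C * A ^ j

lemma GeomBounded.add {X Y : ℕ → ℝ → ℝ} (hX : GeomBounded X) (hY : GeomBounded Y) :
    GeomBounded fun j x => X j x + Y j x := by
  intro T
  obtain ⟨C, A, hC, hA, h⟩ := hX T
  obtain ⟨C', A', hC', hA', h'⟩ := hY T
  refine ⟨C + C', max A A', by positivity, le_max_of_le_left hA, fun j x hx => ?_⟩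
  calc |X j x + Y j x| ≤ |X j x| + |Y j x| := abs_add_le _ _
    _ ≤ C * A ^ j + C' * A' ^ j := add_le_add (h j x hx) (h' j x hx)
    _ ≤ C * max A A' ^ j + C' * max A A' ^ j := by
      gcongr
      · exact le_max_left _ _
      · exact le_max_right _ _
    _ = _ := by ring

lemma GeomBounded.const_mul {X : ℕ → ℝ → ℝ} (hX : GeomBounded X) (c : ℝ) :
    GeomBounded fun j x => c * X j x := by
  intro T
  obtain ⟨C, A, hC, hA, h⟩ := hX T
  refine ⟨|c| * C, A, by positivity, hA, fun j x hx => ?_⟩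
  rw [abs_mul, mul_assoc]
  exact mul_le_mul_of_nonneg_left (h j x hx) (abs_nonneg c)

lemma GeomBounded.shift {X : ℕ → ℝ → ℝ} (hX : GeomBounded X) :
    GeomBounded fun j x => X (j + 1) x := by
  intro T
  obtain ⟨C, A, hC, hA, h⟩ := hX T
  refine ⟨C * A, A, by positivity, hA, fun j x hx => ?_⟩
  rw [mul_assoc, ← pow_succ']
  exact h (j + 1) x hx

lemma abs_conv_le {f g : ℝ → ℝ} {B C T x : ℝ} (hf : ∀ y ∈ Icc 0 T, |f y| ≤ B)
    (hg : ∀ y ∈ Icc 0 T, |g y| ≤ C) (hx : x ∈ Icc 0 T) : |conv f g x| ≤ B * T * C := by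
  have hT : 0 ≤ T := hx.1.trans hx.2
  have hB : 0 ≤ B := (abs_nonneg _).trans (hf 0 ⟨le_rfl, hT⟩)
  have hC : 0 ≤ C := (abs_nonneg _).trans (hg 0 ⟨le_rfl, hT⟩)
  have h := intervalIntegral.norm_integral_le_of_norm_le_const (a := 0) (b := x) (C := B * C)
    (f := fun s => f (x - s) * g s) (by
      intro s hs
      rw [uIoc_of_le hx.1] at hs
      rw [Real.norm_eq_abs, abs_mul]
      exact mul_le_mul (hf _ ⟨by linarith [hs.2], by linarith [hs.1, hx.2]⟩)
        (hg _ ⟨hs.1.le, hs.2.trans hx.2⟩) (abs_nonneg _) hB)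
  rw [Real.norm_eq_abs, sub_zero, abs_of_nonneg hx.1] at h
  calc |conv f g x| ≤ B * C * x := h
    _ ≤ B * C * T := mul_le_mul_of_nonneg_left hx.2 (mul_nonneg hB hC)
    _ = _ := by ring

lemma geomBounded_convPowDeriv {M : ℝ → ℝ} (hM : ContDiffOn ℝ (⊤ : ℕ∞) M (Ici 0)) (k : ℕ) :
    GeomBounded fun j => convPowDeriv M j k := by
  intro T
  have hb : ∀ i, ∃ B, ∀ x ∈ Icc 0 T, ‖iteratedDerivWithin i M (Ici 0) x‖ ≤ B := fun i =>
    isCompact_Icc.exists_bound_of_continuousOn fun x hx =>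
      (hasDerivWithinAt_iteratedDerivWithin_Ici hM i hx.1).continuousWithinAt.mono fun y hy => hy.1
  choose b hb using hb
  set B : ℝ := ∑ i ∈ Finset.range (k + 1), |b i| with hBdef
  have hB0 : 0 ≤ B := Finset.sum_nonneg fun i _ => abs_nonneg _
  have hB : ∀ i ≤ k, ∀ x ∈ Icc 0 T, |iteratedDerivWithin i M (Ici 0) x| ≤ B := fun i hi x hx =>
    (hb i x hx).trans <| (le_abs_self _).trans <|
      Finset.single_le_sum (f := fun i => |b i|) (fun i _ => abs_nonneg _)
        (Finset.mem_range.2 (by omega))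
  rcases lt_or_ge T 0 with hT | hT
  · exact ⟨0, 0, le_rfl, le_rfl, fun j x hx => absurd (hx.1.trans hx.2) (not_le.2 hT)⟩
  set A : ℝ := B * (1 + k + T) with hA
  have hA0 : 0 ≤ A := by positivity
  have key : ∀ j, ∀ i ≤ k, ∀ x ∈ Icc 0 T, |convPowDeriv M j i x| ≤ A ^ j := by
    intro j
    induction j using Nat.twoStepInduction with
    | zero => intro i _ x _; simp [convPowDeriv]
    | one =>
      intro i hi x hx
      rw [pow_one]
      refine (hB i hi x hx).trans ?_
      rw [hA]
      nlinarith [mul_nonneg hB0 hT, mul_nonneg hB0 (Nat.cast_nonneg (α := ℝ) k)]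
    | more j _ ih =>
      intro i hi x hx
      have h1 : |∑ p ∈ Finset.range i,
          iteratedDerivWithin p M (Ici 0) 0 * convPowDeriv M (j + 1) (i - 1 - p) x| ≤
          k * (B * A ^ (j + 1)) := by
        refine (Finset.abs_sum_le_sum_abs _ _).trans ?_
        refine (Finset.sum_le_card_nsmul _ _ (B * A ^ (j + 1)) fun p hp => ?_).trans ?_
        · have := Finset.mem_range.1 hp
          rw [abs_mul]
          exact mul_le_mul (hB p (by omega) 0 ⟨le_rfl, hT⟩) (ih _ (by omega) x hx)
            (abs_nonneg _) hB0
        · rw [Finset.card_range, nsmul_eq_mul]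
          gcongr
      have h2 : |conv (iteratedDerivWithin i M (Ici 0)) (convPow M (j + 1)) x| ≤
          B * T * A ^ (j + 1) :=
        abs_conv_le (hB i hi) (fun y hy => by
          rw [← convPowDeriv_order_zero]; exact ih 0 (Nat.zero_le _) y hy) hx
      calc |convPowDeriv M (j + 2) i x| ≤ _ + _ := abs_add_le _ _
        _ ≤ k * (B * A ^ (j + 1)) + B * T * A ^ (j + 1) := add_le_add h1 h2
        _ = (B * (k + T)) * A ^ (j + 1) := by ring
        _ ≤ A * A ^ (j + 1) := by
          refine mul_le_mul_of_nonneg_right ?_ (by positivity)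
          rw [hA]
          nlinarith
        _ = A ^ (j + 2) := by ring
  exact ⟨1, A, zero_le_one, hA0, fun j x hx => by simpa using key j k le_rfl x hx⟩

/-- The `p`-th derivative of `u ↦ u ^ j / j!` evaluated at `u = -s`. -/
noncomputable def expTerm (j p : ℕ) (s : ℝ) : ℝ :=
  if p ≤ j then (-s) ^ (j - p) / ((j - p).factorial : ℝ) else 0

lemma hasDerivAt_expTerm (j p : ℕ) (s : ℝ) :
    HasDerivAt (expTerm j p) (-expTerm j (p + 1) s) s := by
  unfold expTerm
  rcases lt_trichotomy p j with h | h | h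
  · obtain ⟨m, rfl⟩ := Nat.exists_eq_add_of_lt h
    simp only [if_pos h.le, if_pos (Nat.succ_le_of_lt h)]
    rw [show p + m + 1 - p = m + 1 by omega, show p + m + 1 - (p + 1) = m by omega]
    have h1 := (((hasDerivAt_id s).neg).pow (m + 1)).div_const ((m + 1).factorial : ℝ)
    refine h1.congr_deriv ?_
    have h2 : (m.factorial : ℝ) ≠ 0 := by exact_mod_cast m.factorial_ne_zero
    rw [Nat.factorial_succ]
    push_cast
    simp only [id, Pi.neg_apply]
    field_simp
  · subst h
    simpa using hasDerivAt_const s (1 : ℝ)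
  · simp only [if_neg (not_le.2 h), if_neg (show ¬ p + 1 ≤ j by omega), neg_zero]
    exact hasDerivAt_const s (0 : ℝ)

lemma expTerm_neg_nonneg (j p : ℕ) {S : ℝ} (hS : 0 ≤ S) : 0 ≤ expTerm j p (-S) := by
  unfold expTerm
  split_ifs
  · rw [neg_neg]; positivity
  · exact le_rfl

lemma abs_expTerm_le (j p : ℕ) {s S : ℝ} (hs : |s| ≤ S) :
    |expTerm j p s| ≤ expTerm j p (-S) := by
  unfold expTerm
  split_ifs
  · rw [abs_div, abs_pow, abs_neg, neg_neg, Nat.abs_cast]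
    gcongr
  · simp

lemma summable_expTerm_mul_pow (p : ℕ) (s A : ℝ) :
    Summable fun j => expTerm j p s * A ^ j := by
  rw [← summable_nat_add_iff p]
  refine ((Real.summable_pow_div_factorial (-s * A)).mul_left (A ^ p)).congr fun j => ?_
  simp only [expTerm, if_pos (Nat.le_add_left p j), Nat.add_sub_cancel]
  ring

/-- The series `∑_j (d/du)^p (u^j / j!)|_{u = -s} X_j(t - s)`. -/
noncomputable def expSeries (X : ℕ → ℝ → ℝ) (p : ℕ) (t s : ℝ) : ℝ :=
  ∑' j, expTerm j p s * X j (t - s)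

lemma summable_expSeries {X : ℕ → ℝ → ℝ} (hX : GeomBounded X) (p : ℕ) {t s : ℝ} (hs : s ≤ t) :
    Summable fun j => expTerm j p s * X j (t - s) := by
  obtain ⟨C, A, hC, hA, h⟩ := hX (t - s)
  refine Summable.of_norm_bounded
    ((summable_expTerm_mul_pow p (-|s|) A).mul_left C) fun j => ?_
  rw [Real.norm_eq_abs, abs_mul]
  calc |expTerm j p s| * |X j (t - s)| ≤ expTerm j p (-|s|) * (C * A ^ j) :=
        mul_le_mul (abs_expTerm_le j p le_rfl) (h j _ ⟨by linarith, le_rfl⟩) (abs_nonneg _)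
          (expTerm_neg_nonneg j p (abs_nonneg s))
    _ = _ := by ring

/-- A function differentiable on `[0,∞)` extends linearly to the line. -/
lemma hasDerivAt_linear_extension {f f' : ℝ → ℝ}
    (hf : ∀ x, 0 ≤ x → HasDerivWithinAt f (f' x) (Ici 0) x) (x : ℝ) :
    HasDerivAt (fun y => f (max y 0) + f' 0 * min y 0) (f' (max x 0)) x := by
  have hL : ∀ z ≤ 0, HasDerivWithinAt (fun y => f (max y 0) + f' 0 * min y 0) (f' 0) (Iic 0) z := by
    intro z hz
    have h : HasDerivWithinAt (fun y => f 0 + f' 0 * y) (f' 0) (Iic 0) z := by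
      simpa using (((hasDerivAt_id z).const_mul (f' 0)).const_add (f 0)).hasDerivWithinAt
    refine h.congr (fun y hy => ?_) ?_
    · simp [max_eq_right (mem_Iic.1 hy), min_eq_left (mem_Iic.1 hy)]
    · simp [max_eq_right hz, min_eq_left hz]
  have hR : ∀ z, 0 ≤ z →
      HasDerivWithinAt (fun y => f (max y 0) + f' 0 * min y 0) (f' z) (Ici 0) z := by
    intro z hz
    refine (hf z hz).congr (fun y hy => ?_) ?_
    · simp [max_eq_left (mem_Ici.1 hy), min_eq_right (mem_Ici.1 hy)]
    · simp [max_eq_left hz, min_eq_right hz]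
  rcases lt_trichotomy x 0 with h | h | h
  · rw [max_eq_right h.le]
    exact (hL x h.le).hasDerivAt (Iic_mem_nhds h)
  · subst h
    rw [max_self, ← hasDerivWithinAt_univ, ← Iic_union_Ici (a := (0:ℝ))]
    exact (hL 0 le_rfl).union (hR 0 le_rfl)
  · rw [max_eq_left h.le]
    exact (hR x h.le).hasDerivAt (Ici_mem_nhds h)

lemma hasDerivWithinAt_expSeries {X X' : ℕ → ℝ → ℝ}
    (hX : ∀ j x, 0 ≤ x → HasDerivWithinAt (X j) (X' j x) (Ici 0) x)
    (bX : GeomBounded X) (bX' : GeomBounded X') (p : ℕ) {t s : ℝ} (hs : s ≤ t) :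
    HasDerivWithinAt (expSeries X p t) (-expSeries X (p + 1) t s - expSeries X' p t s)
      (Iic t) s := by
  set Y : ℕ → ℝ → ℝ := fun j y => X j (max y 0) + X' j 0 * min y 0 with hY
  set T : ℝ := t - s + 1 with hT
  have hT0 : 0 ≤ T := by linarith
  set S : ℝ := |t| + |s| + 1 with hS
  have hS0 : 0 ≤ S := by positivity
  obtain ⟨C, A, hC, hA, h⟩ := bX T
  obtain ⟨C', A', hC', hA', h'⟩ := bX' T
  have hYb : ∀ j, ∀ y ∈ Ioo (-1) T, |Y j y| ≤ C * A ^ j + C' * A' ^ j := by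
    intro j y hy
    refine (abs_add_le _ _).trans (add_le_add ?_ ?_)
    · exact h j _ ⟨le_max_right _ _, max_le hy.2.le hT0⟩
    · rw [abs_mul]
      have h1 : |min y 0| ≤ 1 := by
        rw [abs_le]
        exact ⟨le_min hy.1.le (by norm_num), (min_le_right _ _).trans (by norm_num)⟩
      calc |X' j 0| * |min y 0| ≤ (C' * A' ^ j) * 1 :=
            mul_le_mul (h' j 0 ⟨le_rfl, hT0⟩) h1 (abs_nonneg _) (by positivity)
        _ = _ := mul_one _
  have hmem : s ∈ Ioo (s - 1) (t + 1) := ⟨by linarith, by linarith⟩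
  have hYX : ∀ j, ∀ r ≤ t, Y j (t - r) = X j (t - r) := fun j r hr => by
    simp [hY, max_eq_left (sub_nonneg.2 hr), min_eq_right (sub_nonneg.2 hr)]
  have main := hasDerivAt_tsum_of_isPreconnected (𝕜 := ℝ)
    (u := fun j => expTerm j (p + 1) (-S) * (C * A ^ j + C' * A' ^ j) +
      expTerm j p (-S) * (C' * A' ^ j))
    (t := Ioo (s - 1) (t + 1)) (y₀ := s) (y := s)
    (g := fun j r => expTerm j p r * Y j (t - r))
    (g' := fun j r => -expTerm j (p + 1) r * Y j (t - r) +
      expTerm j p r * -X' j (max (t - r) 0))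
    (by
      have e1 := (summable_expTerm_mul_pow (p + 1) (-S) A).mul_left C
      have e2 := (summable_expTerm_mul_pow (p + 1) (-S) A').mul_left C'
      have e3 := (summable_expTerm_mul_pow p (-S) A').mul_left C'
      exact ((e1.add e2).add e3).congr fun j => by ring)
    isOpen_Ioo isPreconnected_Ioo
    (fun j r _ => (hasDerivAt_expTerm j p r).mul
      ((hasDerivAt_linear_extension (hX j) (t - r)).comp_const_sub t r))
    (by
      intro j r hr
      have hrS : |r| ≤ S := by
        rw [abs_le]
        constructor
        · linarith [hr.1, neg_abs_le s, abs_nonneg t]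
        · linarith [hr.2, le_abs_self t, abs_nonneg s]
      rw [Real.norm_eq_abs]
      refine (abs_add_le _ _).trans (add_le_add ?_ ?_)
      · rw [abs_mul, abs_neg]
        exact mul_le_mul (abs_expTerm_le j _ hrS)
          (hYb j _ ⟨by linarith [hr.2], by linarith [hr.1]⟩) (abs_nonneg _)
          (expTerm_neg_nonneg j _ hS0)
      · rw [abs_mul, abs_neg]
        exact mul_le_mul (abs_expTerm_le j _ hrS)
          (h' j _ ⟨le_max_right _ _, max_le (by linarith [hr.1]) hT0⟩) (abs_nonneg _)
          (expTerm_neg_nonneg j _ hS0))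
    hmem
    ((summable_expSeries bX p hs).congr fun j => by rw [hYX j s hs])
    hmem
  have hval : ∑' j, (-expTerm j (p + 1) s * Y j (t - s) +
      expTerm j p s * -X' j (max (t - s) 0)) =
      -expSeries X (p + 1) t s - expSeries X' p t s := by
    unfold expSeries
    rw [← tsum_neg, ← (summable_expSeries bX (p + 1) hs).neg.tsum_sub
      (summable_expSeries bX' p hs)]
    refine tsum_congr fun j => ?_
    rw [hYX j s hs, max_eq_left (sub_nonneg.2 hs)]
    ring
  rw [hval] at main
  refine main.hasDerivWithinAt.congr (fun r hr => ?_) ?_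
  · exact tsum_congr fun j => by rw [hYX j r hr]
  · exact tsum_congr fun j => by rw [hYX j s hs]

/-- The iterated convolutions `M * (M * ⋯ (M * w))`. -/
noncomputable def iterConv (M w : ℝ → ℝ) : ℕ → ℝ → ℝ
  | 0 => w
  | j + 1 => conv M (iterConv M w j)

lemma geomBounded_iterConv {M w : ℝ → ℝ} (hM : ContinuousOn M (Ici 0))
    (hw : ContinuousOn w (Ici 0)) : GeomBounded (iterConv M w) := by
  intro T
  obtain ⟨B, hB⟩ := (isCompact_Icc (a := (0:ℝ)) (b := T)).exists_bound_of_continuousOn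
    (hM.mono fun x hx => hx.1)
  obtain ⟨C, hC⟩ := (isCompact_Icc (a := (0:ℝ)) (b := T)).exists_bound_of_continuousOn
    (hw.mono fun x hx => hx.1)
  rcases lt_or_ge T 0 with hT | hT
  · exact ⟨0, 0, le_rfl, le_rfl, fun j x hx => absurd (hx.1.trans hx.2) (not_le.2 hT)⟩
  have hB0 : 0 ≤ B := (norm_nonneg _).trans (hB 0 ⟨le_rfl, hT⟩)
  have hC0 : 0 ≤ C := (norm_nonneg _).trans (hC 0 ⟨le_rfl, hT⟩)
  refine ⟨C, B * T, hC0, mul_nonneg hB0 hT, fun j => ?_⟩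
  induction j with
  | zero => intro x hx; simpa [iterConv] using hC x hx
  | succ j ih =>
    intro x hx
    refine (abs_conv_le hB ih hx).trans_eq ?_
    ring

/-- Differentiation of a convolution on `[0,∞)`, with the derivative falling on the second
factor. -/
lemma hasDerivWithinAt_conv_right {f g g' : ℝ → ℝ} (hf : ContinuousOn f (Ici 0))
    (hg : ∀ x, 0 ≤ x → HasDerivWithinAt g (g' x) (Ici 0) x)
    (hg' : ContinuousOn g' (Ici 0)) {t : ℝ} (ht : 0 ≤ t) :
    HasDerivWithinAt (conv f g) (g 0 * f t + conv f g' t) (Ici 0) t := by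
  rw [conv_comm f g, conv_comm f g']
  exact hasDerivWithinAt_conv hg hg' hf ht

section MemorySolution

variable {M w : ℝ → ℝ} {η : ℝ}

lemma hasDerivWithinAt_iterConv (hM : ContDiffOn ℝ (⊤ : ℕ∞) M (Ici 0))
    (hw : IsMemorySol M η w) (j : ℕ) : ∀ x, 0 ≤ x →
      HasDerivWithinAt (iterConv M w j)
        (convPow M j x + -η * iterConv M w j x + -1 * iterConv M w (j + 1) x) (Ici 0) x := by
  have hMc : ContinuousOn M (Ici 0) := hM.continuousOn
  have hMd : ∀ x, 0 ≤ x →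
      HasDerivWithinAt M (iteratedDerivWithin 1 M (Ici 0) x) (Ici 0) x := fun x hx => by
    simpa using hasDerivWithinAt_iteratedDerivWithin_Ici hM 0 hx
  have hMd' : ContinuousOn (iteratedDerivWithin 1 M (Ici 0)) (Ici 0) := fun x hx =>
    (hasDerivWithinAt_iteratedDerivWithin_Ici hM 1 hx).continuousWithinAt
  induction j with
  | zero =>
    intro x hx
    have h := (hw.1.differentiableOn one_ne_zero x hx).hasDerivWithinAt
    refine h.congr_deriv ?_
    have := hw.2.2 x hx
    simp only [convPow, iterConv, conv]
    linarith
  | succ j ih =>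
    intro x hx
    have hc0 : ContinuousOn (iterConv M w j) (Ici 0) := fun y hy => (ih y hy).continuousWithinAt
    have hc1 : ContinuousOn (iterConv M w (j + 1)) (Ici 0) := fun y hy =>
      (hasDerivWithinAt_conv hMd hMd' hc0 hy).continuousWithinAt
    have hcp := continuousOn_convPow hM j
    have h1 : ContinuousOn (fun y => convPow M j y + -η * iterConv M w j y) (Ici 0) :=
      hcp.add (continuousOn_const.mul hc0)
    have h2 : ContinuousOn (fun y => -1 * iterConv M w (j + 1) y) (Ici 0) :=
      continuousOn_const.mul hc1
    refine (hasDerivWithinAt_conv_right hMc ih (h1.add h2) hx).congr_deriv ?_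
    have hsplit : conv M (fun y => convPow M j y + -η * iterConv M w j y +
        -1 * iterConv M w (j + 1) y) x = conv M (convPow M j) x + -η * iterConv M w (j + 1) x +
        -1 * iterConv M w (j + 2) x := by
      have i0 := conv_intervalIntegrable hMc hcp hx
      have i1 := (conv_intervalIntegrable hMc hc0 hx).const_mul (-η)
      have i2 := (conv_intervalIntegrable hMc hc1 hx).const_mul (-1)
      change _ = conv M (convPow M j) x + -η * conv M (iterConv M w j) x +
        -1 * conv M (iterConv M w (j + 1)) x
      generalize iterConv M w (j + 1) = v at *
      unfold conv
      rw [← intervalIntegral.integral_const_mul, ← intervalIntegral.integral_const_mul,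
        ← intervalIntegral.integral_add i0 i1, ← intervalIntegral.integral_add (i0.add i1) i2]
      refine intervalIntegral.integral_congr fun s _ => ?_
      ring
    rw [hsplit]
    cases j with
    | zero =>
      have h0 : conv M (convPow M 0) x = 0 := by simp [conv, convPow]
      rw [h0]
      simp only [iterConv, convPow, hw.2.1]
      ring
    | succ j =>
      have h0 : iterConv M w (j + 1) 0 = 0 := by simp [iterConv, conv]
      rw [h0]
      simp only [convPow]
      ring

lemma expSeries_one (X : ℕ → ℝ → ℝ) (hX : GeomBounded X) {t s : ℝ} (hs : s ≤ t) :
    expSeries X 1 t s = expSeries (fun j => X (j + 1)) 0 t s := by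
  unfold expSeries
  rw [(summable_expSeries hX 1 hs).tsum_eq_zero_add]
  simp [expTerm]

lemma expSeries_add {X Y : ℕ → ℝ → ℝ} (hX : GeomBounded X) (hY : GeomBounded Y) (p : ℕ)
    {t s : ℝ} (hs : s ≤ t) :
    expSeries (fun j x => X j x + Y j x) p t s = expSeries X p t s + expSeries Y p t s := by
  unfold expSeries
  rw [← (summable_expSeries hX p hs).tsum_add (summable_expSeries hY p hs)]
  exact tsum_congr fun j => by ring

lemma expSeries_const_mul (X : ℕ → ℝ → ℝ) (c : ℝ) (p : ℕ) (t s : ℝ) :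
    expSeries (fun j x => c * X j x) p t s = c * expSeries X p t s := by
  unfold expSeries
  rw [← tsum_mul_left]
  exact tsum_congr fun j => by ring

lemma expSeries_at_zero (X : ℕ → ℝ → ℝ) (p : ℕ) (t : ℝ) : expSeries X p t 0 = X p t := by
  unfold expSeries
  rw [tsum_eq_single p]
  · simp [expTerm]
  · intro j hj
    rcases lt_or_gt_of_ne hj with h | h
    · simp [expTerm, not_le.2 h]
    · simp [expTerm, h.le, Nat.sub_ne_zero_of_lt h]

lemma KM_eq_expSeries (M : ℝ → ℝ) (t s : ℝ) :
    KM M t s = expSeries (fun j => convPowDeriv M j 0) 0 t s := by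
  simp [KM, expSeries, expTerm, convPowDeriv_order_zero]

/-- The flow representation `w(t) = e^{-ηt} + ∫_0^t e^{-ηs} K_M(t,s) ds`. -/
lemma memorySol_eq_integral_KM (hM : ContDiffOn ℝ (⊤ : ℕ∞) M (Ici 0))
    (hw : IsMemorySol M η w) {t : ℝ} (ht : 0 ≤ t)
    (hK : ContinuousOn (KM M t) (Iic t)) :
    w t = Real.exp (-η * t) + ∫ s in (0:ℝ)..t, Real.exp (-η * s) * KM M t s := by
  have bW : GeomBounded (iterConv M w) := geomBounded_iterConv hM.continuousOn hw.1.continuousOn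
  have bP : GeomBounded (convPow M) := by
    simpa only [convPowDeriv_order_zero] using geomBounded_convPowDeriv hM 0
  have bW' := (bP.add (bW.const_mul (-η))).add (bW.shift.const_mul (-1))
  have hderiv : ∀ s ≤ t, HasDerivWithinAt
      (fun s => Real.exp (-η * s) * expSeries (iterConv M w) 0 t s)
      (-(Real.exp (-η * s) * KM M t s)) (Iic t) s := by
    intro s hs
    have h1 : HasDerivAt (fun s => Real.exp (-η * s)) (Real.exp (-η * s) * -η) s := by
      simpa using ((hasDerivAt_id s).const_mul (-η)).exp
    refine (h1.hasDerivWithinAt.mul (hasDerivWithinAt_expSeries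
      (hasDerivWithinAt_iterConv hM hw) bW bW' 0 hs)).congr_deriv ?_
    rw [expSeries_add (bP.add (bW.const_mul (-η))) (bW.shift.const_mul (-1)) 0 hs,
      expSeries_add bP (bW.const_mul (-η)) 0 hs, expSeries_const_mul, expSeries_const_mul,
      zero_add, expSeries_one _ bW hs, KM_eq_expSeries]
    simp only [convPowDeriv_order_zero]
    ring
  have hsub : uIcc 0 t ⊆ Iic t := fun s hs => by
    rw [uIcc_of_le ht] at hs; exact hs.2
  have hFTC := intervalIntegral.integral_eq_sub_of_hasDeriv_right_of_le ht
    (f := fun s => Real.exp (-η * s) * expSeries (iterConv M w) 0 t s)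
    (f' := fun s => -(Real.exp (-η * s) * KM M t s))
    (fun s hs => (hderiv s hs.2).continuousWithinAt.mono fun y hy => hy.2)
    (fun s hs => ((hderiv s hs.2.le).hasDerivAt (Iic_mem_nhds hs.2)).hasDerivWithinAt)
    (ContinuousOn.intervalIntegrable
      (ContinuousOn.neg (ContinuousOn.mul (by fun_prop) (hK.mono hsub))))
  have h0 : expSeries (iterConv M w) 0 t t = 1 := by
    unfold expSeries
    rw [tsum_eq_single 0]
    · simp [expTerm, iterConv, hw.2.1]
    · intro j hj
      obtain ⟨i, rfl⟩ := Nat.exists_eq_succ_of_ne_zero hj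
      simp [iterConv, conv]
  rw [intervalIntegral.integral_neg, h0, expSeries_at_zero] at hFTC
  simp only [iterConv, mul_zero, Real.exp_zero, one_mul, mul_one] at hFTC
  linarith

end MemorySolution

/-- The `k`-th derivative in `s` of the flow kernel. -/
noncomputable def KMderiv (M : ℝ → ℝ) (t : ℝ) (k : ℕ) (s : ℝ) : ℝ :=
  (-1) ^ k * ∑ ij ∈ Finset.HasAntidiagonal.antidiagonal k,
    (k.choose ij.1 : ℝ) * expSeries (fun j => convPowDeriv M j ij.2) ij.1 t s

lemma KMderiv_zero (M : ℝ → ℝ) (t : ℝ) : KMderiv M t 0 = KM M t := by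
  funext s
  simp [KMderiv, KM_eq_expSeries]

lemma hasDerivWithinAt_KMderiv {M : ℝ → ℝ} (hM : ContDiffOn ℝ (⊤ : ℕ∞) M (Ici 0)) (t : ℝ) (k : ℕ)
    {s : ℝ} (hs : s ≤ t) :
    HasDerivWithinAt (KMderiv M t k) (KMderiv M t (k + 1) s) (Iic t) s := by
  have h := (HasDerivWithinAt.fun_sum (u := Finset.HasAntidiagonal.antidiagonal k) fun ij _ =>
    (hasDerivWithinAt_expSeries (fun j x hx => hasDerivWithinAt_convPowDeriv hM j ij.2 x hx)
      (geomBounded_convPowDeriv hM ij.2) (geomBounded_convPowDeriv hM (ij.2 + 1)) ij.1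
      hs).const_mul (k.choose ij.1 : ℝ)).const_mul ((-1 : ℝ) ^ k)
  refine h.congr_deriv ?_
  unfold KMderiv
  rw [Finset.sum_antidiagonal_choose_succ_mul
    (fun p q => expSeries (fun j => convPowDeriv M j q) p t s), ← Finset.sum_add_distrib,
    pow_succ, mul_assoc, Finset.mul_sum _ _ (-1 : ℝ)]
  congr 1
  refine Finset.sum_congr rfl fun ij hij => ?_
  rw [Finset.HasAntidiagonal.mem_antidiagonal] at hij
  rw [show k.choose ij.2 = k.choose ij.1 from Nat.choose_symm_of_eq_add (by omega)]
  ring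

lemma iteratedDerivWithin_KM {M : ℝ → ℝ} (hM : ContDiffOn ℝ (⊤ : ℕ∞) M (Ici 0)) (k : ℕ)
    {t s : ℝ} (hs : s ≤ t) :
    iteratedDerivWithin k (fun s' => KM M t s') (Iic t) s = KMderiv M t k s := by
  have := iteratedDerivWithin_eq_of_hasDerivWithinAt (uniqueDiffOn_Iic t)
    (fun k x hx => hasDerivWithinAt_KMderiv hM t k hx) k s hs
  rwa [KMderiv_zero] at this

lemma KMderiv_at_zero {M : ℝ → ℝ} (hM : ContDiffOn ℝ (⊤ : ℕ∞) M (Ici 0)) (l : ℕ) {t : ℝ}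
    (ht : 0 ≤ t) : KMderiv M t l 0 = hcoef M l t := by
  unfold KMderiv hcoef
  rw [Finset.Nat.sum_antidiagonal_eq_sum_range_succ_mk]
  congr 1
  refine Finset.sum_congr rfl fun j hj => ?_
  have : j ≤ l := by have := Finset.mem_range.1 hj; omega
  simp only
  rw [expSeries_at_zero, iteratedDerivWithin_convPow hM _ _ ht, Nat.choose_symm this]

lemma KMderiv_at_diagonal {M : ℝ → ℝ} (hM : ContDiffOn ℝ (⊤ : ℕ∞) M (Ici 0)) (l : ℕ) (t : ℝ) :
    KMderiv M t l t = -pcoef M l t := by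
  have hser : ∀ p q, q ≤ l → expSeries (fun j => convPowDeriv M j q) p t t =
      ∑ j ∈ Finset.range (l + 2), expTerm j p t * convPowDeriv M j q 0 := by
    intro p q hq
    unfold expSeries
    rw [sub_self, tsum_eq_sum]
    intro j hj
    rw [Finset.mem_range, not_lt] at hj
    simp only [convPowDeriv_apply_zero M j q (by omega), mul_zero]
  have hinner : ∀ j ∈ Finset.range (l + 1),
      ∑ m ∈ Finset.Icc 1 (j + 1),
        (if 2 * (j + 1) ≤ m + l + 1 then
          (l.choose (l + m - (j + 1)) : ℝ) *
            iteratedDerivWithin (l + m - (j + 1)) (convPow M (j + 1)) (Ici 0) 0 *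
            ((-t) ^ m / (m.factorial : ℝ))
        else 0) =
      ∑ p ∈ Finset.range (j + 1),
        (l.choose p : ℝ) * (expTerm (j + 1) p t * convPowDeriv M (j + 1) (l - p) 0) := by
    intro j hj
    have hjl : j ≤ l := by have := Finset.mem_range.1 hj; omega
    refine Finset.sum_bij' (fun m _ => j + 1 - m) (fun p _ => j + 1 - p) ?_ ?_ ?_ ?_ ?_
    · intro m hm; simp only [Finset.mem_Icc, Finset.mem_range] at *; omega
    · intro m hm; simp only [Finset.mem_Icc, Finset.mem_range] at *; omega
    · intro m hm; simp only [Finset.mem_Icc] at *; omega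
    · intro m hm; simp only [Finset.mem_range] at *; omega
    · intro m hm
      rw [Finset.mem_Icc] at hm
      rw [show l + m - (j + 1) = l - (j + 1 - m) by omega, Nat.choose_symm (by omega),
        iteratedDerivWithin_convPow hM _ _ le_rfl]
      split_ifs with h
      · rw [expTerm, if_pos (Nat.sub_le _ _), Nat.sub_sub_self hm.2]
        ring
      · rw [convPowDeriv_apply_zero M (j + 1) _ (by omega)]
        ring
  have hsplit : ∀ j ∈ Finset.range (l + 2),
      ∑ p ∈ Finset.range (l + 1),
        (l.choose p : ℝ) * (expTerm j p t * convPowDeriv M j (l - p) 0) =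
      ∑ p ∈ Finset.range j, (l.choose p : ℝ) * (expTerm j p t * convPowDeriv M j (l - p) 0) +
        if j < l + 1 then (l.choose j : ℝ) * convPowDeriv M j (l - j) 0 else 0 := by
    intro j hj
    split_ifs with h
    · rw [← Finset.sum_subset (Finset.range_mono (Nat.succ_le_of_lt h)), Finset.sum_range_succ]
      · simp [expTerm]
      · intro p _ hp
        rw [Finset.mem_range] at hp
        rw [expTerm, if_neg (by omega)]
        ring
    · have : j = l + 1 := by have := Finset.mem_range.1 hj; omega
      rw [this, add_zero]
  have hh : hcoef M l 0 = (-1) ^ l * ∑ j ∈ Finset.range (l + 1),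
      (l.choose j : ℝ) * convPowDeriv M j (l - j) 0 := by
    rw [← KMderiv_at_zero hM l le_rfl, KMderiv, Finset.Nat.sum_antidiagonal_eq_sum_range_succ_mk]
    simp only [expSeries_at_zero]
  have hif : ∑ j ∈ Finset.range (l + 2),
      (if j < l + 1 then (l.choose j : ℝ) * convPowDeriv M j (l - j) 0 else 0) =
      ∑ j ∈ Finset.range (l + 1), (l.choose j : ℝ) * convPowDeriv M j (l - j) 0 := by
    rw [Finset.sum_range_succ, if_neg (lt_irrefl _), add_zero]
    exact Finset.sum_congr rfl fun j hj => if_pos (Finset.mem_range.1 hj)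
  have hp : ∑ j ∈ Finset.Icc 1 (l + 1), ∑ m ∈ Finset.Icc 1 j,
      (if 2 * j ≤ m + l + 1 then
        (l.choose (l + m - j) : ℝ) * iteratedDerivWithin (l + m - j) (convPow M j) (Ici 0) 0 *
          ((-t) ^ m / (m.factorial : ℝ))
      else 0) =
      ∑ j ∈ Finset.range (l + 2), ∑ p ∈ Finset.range j,
        (l.choose p : ℝ) * (expTerm j p t * convPowDeriv M j (l - p) 0) := by
    rw [Finset.sum_range_succ', Finset.range_zero, Finset.sum_empty, add_zero,
      show Finset.Icc 1 (l + 1) = Finset.Ico 1 (l + 2) from rfl, Finset.sum_Ico_eq_sum_range]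
    refine Finset.sum_congr rfl fun j hj => ?_
    rw [add_comm 1 j]
    exact hinner j hj
  rw [pcoef, hp, hh, KMderiv, Finset.Nat.sum_antidiagonal_eq_sum_range_succ_mk]
  have hsum : ∑ p ∈ Finset.range (l + 1),
      (l.choose p : ℝ) * expSeries (fun j => convPowDeriv M j (l - p)) p t t =
      ∑ j ∈ Finset.range (l + 2), ∑ p ∈ Finset.range j,
        (l.choose p : ℝ) * (expTerm j p t * convPowDeriv M j (l - p) 0) +
      ∑ j ∈ Finset.range (l + 1), (l.choose j : ℝ) * convPowDeriv M j (l - j) 0 := by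
    simp only [hser _ _ (Nat.sub_le l _), Finset.mul_sum]
    rw [Finset.sum_comm, Finset.sum_congr rfl hsplit, Finset.sum_add_distrib, hif]
  rw [hsum]
  ring

/-- Integration by parts for the remainder kernel. -/
lemma RNrem_eq_boundary_add_RNrem_succ {M : ℝ → ℝ} (hM : ContDiffOn ℝ (⊤ : ℕ∞) M (Ici 0)) (l : ℕ)
    {t η : ℝ} (ht : 0 ≤ t) (hη : η ≠ 0) :
    RNrem M l t η = hcoef M l t + Real.exp (-η * t) * pcoef M l t + RNrem M (l + 1) t η * η⁻¹ := by
  have hsub : uIcc 0 t ⊆ Iic t := fun s hs => by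
    rw [uIcc_of_le ht] at hs; exact hs.2
  have hrem : ∀ k, RNrem M k t η =
      ∫ s in (0:ℝ)..t, η * Real.exp (-η * s) * KMderiv M t k s := fun k =>
    intervalIntegral.integral_congr fun s hs => by
      simp only [iteratedDerivWithin_KM hM k (hsub hs)]
  have hintegral : ∀ k, IntervalIntegrable (fun s => η * Real.exp (-η * s) * KMderiv M t k s)
      volume 0 t := fun k =>
    ContinuousOn.intervalIntegrable <| ContinuousOn.mul (by fun_prop) fun s hs =>
      ((hasDerivWithinAt_KMderiv hM t k (hsub hs)).continuousWithinAt).mono hsub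
  have hderiv : ∀ s ≤ t, HasDerivWithinAt (fun s => -(Real.exp (-η * s) * KMderiv M t l s))
      (η * Real.exp (-η * s) * KMderiv M t l s -
        η⁻¹ * (η * Real.exp (-η * s) * KMderiv M t (l + 1) s)) (Iic t) s := by
    intro s hs
    have h1 : HasDerivAt (fun s => Real.exp (-η * s)) (Real.exp (-η * s) * -η) s := by
      simpa using ((hasDerivAt_id s).const_mul (-η)).exp
    refine (h1.hasDerivWithinAt.mul (hasDerivWithinAt_KMderiv hM t l hs)).neg.congr_deriv ?_
    field_simp
    ring
  have hFTC := intervalIntegral.integral_eq_sub_of_hasDeriv_right_of_le ht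
    (fun s hs => (hderiv s hs.2).continuousWithinAt.mono fun y hy => hy.2)
    (fun s hs => ((hderiv s hs.2.le).hasDerivAt (Iic_mem_nhds hs.2)).hasDerivWithinAt)
    ((hintegral l).sub ((hintegral (l + 1)).const_mul η⁻¹))
  rw [intervalIntegral.integral_sub (hintegral l) ((hintegral (l + 1)).const_mul η⁻¹),
    intervalIntegral.integral_const_mul, ← hrem, ← hrem, KMderiv_at_diagonal hM,
    KMderiv_at_zero hM l ht, mul_zero, Real.exp_zero] at hFTC
  linarith

/-- decomposition of the memory ODE solution.  For `M ∈ C^∞([0,∞))`, an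
integer `N ≥ 2` and `η > 0`, the `C¹` solution `w_η` of the memory ODE satisfies, for `t ≥ 0`,
`w_η(t) = e^{-ηt}(1 + ∑_{l<N} p_l(t) η^{-l-1}) + ∑_{l<N} h_l(t) η^{-l-1} + R_N(t,η) η^{-N-1}`. -/
theorem memory_ode_decomposition
    (M : ℝ → ℝ) (hM : ContDiffOn ℝ (⊤ : ℕ∞) M (Set.Ici 0))
    (N : ℕ) (hN : 2 ≤ N) (η : ℝ) (hη : 0 < η)
    (w : ℝ → ℝ) (hw : IsMemorySol M η w) :
    ∀ t : ℝ, 0 ≤ t →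
      w t = Real.exp (-η * t) *
            (1 + ∑ l ∈ Finset.range N, pcoef M l t * η ^ (-(l : ℤ) - 1)) +
          (∑ l ∈ Finset.range N, hcoef M l t * η ^ (-(l : ℤ) - 1)) +
          RNrem M N t η * η ^ (-(N : ℤ) - 1) := by
  intro t ht
  have hη0 : η ≠ 0 := hη.ne'
  clear hN
  induction N with
  | zero =>
    have hK : ContinuousOn (KM M t) (Iic t) := fun s hs => by
      rw [← KMderiv_zero]
      exact (hasDerivWithinAt_KMderiv hM t 0 hs).continuousWithinAt
    rw [memorySol_eq_integral_KM hM hw ht hK]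
    simp only [Finset.range_zero, Finset.sum_empty, add_zero, mul_one, RNrem,
      iteratedDerivWithin_zero, mul_assoc, intervalIntegral.integral_const_mul]
    simp only [Nat.cast_zero, neg_zero, zero_sub, zpow_neg_one]
    field_simp
  | succ N ih =>
    rw [ih, RNrem_eq_boundary_add_RNrem_succ hM N ht hη0, Finset.sum_range_succ,
      Finset.sum_range_succ]
    have hpow : η ^ (-((N + 1 : ℕ) : ℤ) - 1) = η⁻¹ * η ^ (-(N : ℤ) - 1) := by
      rw [← zpow_neg_one, ← zpow_add₀ hη0]
      congr 1
      push_cast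
      ring
    rw [hpow]
    ring
end

section
/- Let M ∈ C^∞([0,∞), ℝ). For each η > 0, let w_η be the unique C¹ solution on [0,∞) of w′(t) + η w(t) + ∫_0^t M(t-s) w(s) ds = 0 with w(0) = 1. Then for every fixed t > 0, lim_{η → +∞} η² · w_η(t) = −M(t). -/
open Set MeasureTheory

/-- One-sided Grönwall estimate for the damped equation `z' + η z = f`. -/
theorem le_of_deriv_add_mul_le {z z' : ℝ → ℝ} {T η A B : ℝ} (hη : 0 < η) (hB : 0 ≤ B)
    (hc : ContinuousOn z (Icc 0 T)) (hd : ∀ s ∈ Ioo 0 T, HasDerivAt z (z' s) s)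
    (hle : ∀ s ∈ Ioo 0 T, z' s + η * z s ≤ A * η * Real.exp (-(η * s)) + B)
    {s : ℝ} (hs : s ∈ Icc 0 T) :
    z s ≤ (z 0 + A * η * s) * Real.exp (-(η * s)) + B / η := by
  have hexp : ∀ x : ℝ, HasDerivAt (fun x => Real.exp (η * x)) (Real.exp (η * x) * η) x := by
    intro x
    simpa using ((hasDerivAt_id x).const_mul η).exp
  have hanti : AntitoneOn
      (fun x => Real.exp (η * x) * z x - A * η * x - B / η * Real.exp (η * x)) (Icc 0 T) := by
    apply antitoneOn_of_hasDerivWithinAt_nonpos (convex_Icc 0 T)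
      (f' := fun x => Real.exp (η * x) * η * z x + Real.exp (η * x) * z' x - A * η * 1
        - B / η * (Real.exp (η * x) * η))
    · fun_prop
    · intro x hx
      rw [interior_Icc] at hx
      exact ((((hexp x).mul (hd x hx)).sub ((hasDerivAt_id x).const_mul (A * η))).sub
        ((hexp x).const_mul (B / η))).hasDerivWithinAt
    · intro x hx
      rw [interior_Icc] at hx
      have h := mul_le_mul_of_nonneg_left (hle x hx) (Real.exp_pos (η * x)).le
      have he : Real.exp (η * x) * Real.exp (-(η * x)) = 1 := by
        rw [← Real.exp_add]; simp
      have h1 : B / η * (Real.exp (η * x) * η) = B * Real.exp (η * x) := by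
        field_simp
      rw [h1]
      linear_combination h + A * η * he
  have h := hanti (left_mem_Icc.2 (hs.1.trans hs.2)) hs hs.1
  simp only [mul_zero, Real.exp_zero, one_mul, sub_zero, mul_one] at h
  have he : Real.exp (-(η * s)) * Real.exp (η * s) = 1 := by
    rw [← Real.exp_add]; simp
  have h2 := mul_le_mul_of_nonneg_left h (Real.exp_pos (-(η * s))).le
  have h3 : 0 ≤ Real.exp (-(η * s)) * (B / η) := by positivity
  linear_combination h2 + h3 + (-z s + B / η) * he

/-- Two-sided Grönwall estimate for the damped equation `z' + η z = f`. -/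
theorem abs_le_of_abs_deriv_add_mul_le {z z' : ℝ → ℝ} {T η A B : ℝ} (hη : 0 < η) (hB : 0 ≤ B)
    (hc : ContinuousOn z (Icc 0 T)) (hd : ∀ s ∈ Ioo 0 T, HasDerivAt z (z' s) s)
    (hle : ∀ s ∈ Ioo 0 T, |z' s + η * z s| ≤ A * η * Real.exp (-(η * s)) + B)
    {s : ℝ} (hs : s ∈ Icc 0 T) :
    |z s| ≤ (|z 0| + A * η * s) * Real.exp (-(η * s)) + B / η := by
  have h1 := le_of_deriv_add_mul_le hη hB hc hd (fun x hx => (le_abs_self _).trans (hle x hx)) hs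
  have h2 := le_of_deriv_add_mul_le (z := fun x => -z x) (z' := fun x => -z' x) (A := A)
    hη hB hc.neg (fun x hx => (hd x hx).neg)
    (fun x hx => by
      have := (neg_le_abs _).trans (hle x hx)
      linarith) hs
  have he := (Real.exp_pos (-(η * s))).le
  have h3 := mul_le_mul_of_nonneg_right (le_abs_self (z 0)) he
  have h4 := mul_le_mul_of_nonneg_right (neg_le_abs (z 0)) he
  rw [abs_le]
  constructor <;> linarith

theorem integral_exp_neg_mul_le {η : ℝ} (hη : 0 < η) (T : ℝ) :
    ∫ s in (0:ℝ)..T, Real.exp (-(η * s)) ≤ 1 / η := by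
  have hd : ∀ x ∈ uIcc 0 T, HasDerivAt (fun x => -(1 / η) * Real.exp (-(η * x)))
      (Real.exp (-(η * x))) x := by
    intro x _
    refine (((((hasDerivAt_id x).const_mul η).neg).exp).const_mul (-(1 / η))).congr_deriv ?_
    simp only [id, Pi.neg_apply]
    field_simp
  rw [intervalIntegral.integral_eq_sub_of_hasDerivAt hd
    (Continuous.intervalIntegrable (by fun_prop) _ _)]
  have : 0 ≤ 1 / η * Real.exp (-(η * T)) := by positivity
  simp
  simp at this
  linarith

theorem integral_mul_exp_neg_mul_le {η T : ℝ} (hη : 0 < η) (hT : 0 ≤ T) :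
    ∫ s in (0:ℝ)..T, s * Real.exp (-(η * s)) ≤ 1 / η ^ 2 := by
  have hd : ∀ x ∈ uIcc 0 T,
      HasDerivAt (fun x => (-(1 / η) * x - 1 / η ^ 2) * Real.exp (-(η * x)))
      (x * Real.exp (-(η * x))) x := by
    intro x _
    refine ((((hasDerivAt_id x).const_mul (-(1 / η))).sub_const (1 / η ^ 2)).mul
      ((((hasDerivAt_id x).const_mul η).neg).exp)).congr_deriv ?_
    simp only [id, Pi.neg_apply]
    field_simp
    ring
  rw [intervalIntegral.integral_eq_sub_of_hasDerivAt hd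
    (Continuous.intervalIntegrable (by fun_prop) _ _)]
  have : 0 ≤ (1 / η * T + 1 / η ^ 2) * Real.exp (-(η * T)) := by positivity
  simp only [mul_zero, neg_zero, Real.exp_zero]
  linarith

namespace IsMemorySol

variable {M w : ℝ → ℝ} {η T C : ℝ}

theorem continuousOn_Icc (h : IsMemorySol M η w) (T : ℝ) : ContinuousOn w (Icc 0 T) :=
  h.1.continuousOn.mono Icc_subset_Ici_self

theorem hasDerivAt (h : IsMemorySol M η w) {s : ℝ} (hs : 0 < s) :
    HasDerivAt w (derivWithin w (Ici 0) s) s :=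
  ((h.1.differentiableOn one_ne_zero s hs.le).hasDerivWithinAt).hasDerivAt (Ici_mem_nhds hs)

theorem abs_memory_le (h : IsMemorySol M η w) (hC : ∀ s ∈ Icc 0 T, |M s| ≤ C)
    {s : ℝ} (hs : s ∈ Icc 0 T) :
    |∫ r in (0:ℝ)..s, M (s - r) * w r| ≤ C * ∫ r in (0:ℝ)..T, |w r| := by
  have hC0 : 0 ≤ C := (abs_nonneg _).trans (hC s hs)
  have hT : 0 ≤ T := hs.1.trans hs.2
  have hint : ∀ b ∈ Icc 0 T, IntervalIntegrable (fun r => |w r|) volume 0 b := fun b hb =>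
    ContinuousOn.intervalIntegrable_of_Icc hb.1 (h.continuousOn_Icc b).abs
  calc |∫ r in (0:ℝ)..s, M (s - r) * w r| ≤ ∫ r in (0:ℝ)..s, C * |w r| := by
        rw [← Real.norm_eq_abs]
        refine intervalIntegral.norm_integral_le_of_norm_le hs.1 ?_ ((hint s hs).const_mul C)
        refine Filter.Eventually.of_forall fun r hr => ?_
        rw [Real.norm_eq_abs, abs_mul]
        exact mul_le_mul_of_nonneg_right
          (hC _ ⟨by linarith [hr.2], by linarith [hr.1, hs.2]⟩) (abs_nonneg _)
    _ = C * ∫ r in (0:ℝ)..s, |w r| := intervalIntegral.integral_const_mul _ _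
    _ ≤ C * ∫ r in (0:ℝ)..T, |w r| := by
        gcongr
        exact intervalIntegral.integral_mono_interval le_rfl hs.1 hs.2
          (Filter.Eventually.of_forall fun _ => abs_nonneg _) (hint T ⟨hT, le_rfl⟩)

theorem integral_abs_le (h : IsMemorySol M η w) (hη : 0 < η) (hT : 0 ≤ T)
    (hC : ∀ s ∈ Icc 0 T, |M s| ≤ C) (hηC : 2 * C * T ≤ η) :
    ∫ r in (0:ℝ)..T, |w r| ≤ 2 / η := by
  have hC0 : 0 ≤ C := (abs_nonneg _).trans (hC 0 ⟨le_rfl, hT⟩)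
  set I := ∫ r in (0:ℝ)..T, |w r| with hI
  have hI0 : 0 ≤ I := intervalIntegral.integral_nonneg hT fun _ _ => abs_nonneg _
  have hb : ∀ s ∈ Icc 0 T, |w s| ≤ Real.exp (-(η * s)) + C * I / η := by
    intro s hs
    have := abs_le_of_abs_deriv_add_mul_le (A := 0) hη (mul_nonneg hC0 hI0)
      (h.continuousOn_Icc T) (fun x hx => h.hasDerivAt hx.1) (fun x hx => by
        have h1 := h.abs_memory_le hC (Ioo_subset_Icc_self hx)
        have h2 := h.2.2 x hx.1.le
        rw [eq_neg_of_add_eq_zero_left h2, abs_neg]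
        simpa using h1) hs
    simpa [h.2.1] using this
  have h1 : I ≤ ∫ s in (0:ℝ)..T, (Real.exp (-(η * s)) + C * I / η) :=
    intervalIntegral.integral_mono_on hT
      (ContinuousOn.intervalIntegrable_of_Icc hT (h.continuousOn_Icc T).abs)
      (Continuous.intervalIntegrable (by fun_prop) _ _) hb
  rw [intervalIntegral.integral_add (Continuous.intervalIntegrable (by fun_prop) _ _)
    (by simp), intervalIntegral.integral_const] at h1
  have h2 := integral_exp_neg_mul_le hη T
  simp only [sub_zero, smul_eq_mul] at h1
  have h3 : T * (C * I / η) ≤ I / 2 := by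
    rw [← mul_div_assoc, div_le_iff₀ hη]
    nlinarith
  have h4 : 2 / η = 2 * (1 / η) := by ring
  linarith

theorem abs_memory_le_div (h : IsMemorySol M η w) (hη : 0 < η)
    (hC : ∀ s ∈ Icc 0 T, |M s| ≤ C) (hηC : 2 * C * T ≤ η) {s : ℝ} (hs : s ∈ Icc 0 T) :
    |∫ r in (0:ℝ)..s, M (s - r) * w r| ≤ 2 * C / η := by
  have hC0 : 0 ≤ C := (abs_nonneg _).trans (hC s hs)
  refine (h.abs_memory_le hC hs).trans ?_
  refine (mul_le_mul_of_nonneg_left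
    (h.integral_abs_le hη (hs.1.trans hs.2) hC hηC) hC0).trans_eq ?_
  ring

theorem abs_le (h : IsMemorySol M η w) (hη : 0 < η)
    (hC : ∀ s ∈ Icc 0 T, |M s| ≤ C) (hηC : 2 * C * T ≤ η) {s : ℝ} (hs : s ∈ Icc 0 T) :
    |w s| ≤ Real.exp (-(η * s)) + 2 * C / η ^ 2 := by
  have hC0 : 0 ≤ C := (abs_nonneg _).trans (hC s hs)
  have := abs_le_of_abs_deriv_add_mul_le (A := 0) (B := 2 * C / η) hη (by positivity)
    (h.continuousOn_Icc T) (fun x hx => h.hasDerivAt hx.1) (fun x hx => by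
      rw [eq_neg_of_add_eq_zero_left (h.2.2 x hx.1.le), abs_neg]
      simpa using h.abs_memory_le_div hη hC hηC (Ioo_subset_Icc_self hx)) hs
  rw [div_div, ← sq] at this
  simpa [h.2.1] using this

theorem abs_mul_integral_sub_one_le (h : IsMemorySol M η w) (hη : 0 < η)
    (hC : ∀ s ∈ Icc 0 T, |M s| ≤ C) (hηC : 2 * C * T ≤ η) {s : ℝ} (hs : s ∈ Icc 0 T) :
    |η * (∫ r in (0:ℝ)..s, w r) - 1| ≤ |w s| + 2 * C * T / η := by
  have hC0 : 0 ≤ C := (abs_nonneg _).trans (hC s hs)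
  have hw' : IntervalIntegrable (derivWithin w (Ici 0)) volume 0 s :=
    ContinuousOn.intervalIntegrable_of_Icc hs.1
      ((h.1.continuousOn_derivWithin (uniqueDiffOn_Ici 0) le_rfl).mono Icc_subset_Ici_self)
  have hw : IntervalIntegrable w volume 0 s :=
    ContinuousOn.intervalIntegrable_of_Icc hs.1 (h.continuousOn_Icc s)
  have hftc : ∫ r in (0:ℝ)..s, derivWithin w (Ici 0) r = w s - 1 := by
    rw [intervalIntegral.integral_eq_sub_of_hasDerivAt_of_le hs.1 (h.continuousOn_Icc s)
      (fun x hx => h.hasDerivAt hx.1) hw', h.2.1]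
  have hbound : |∫ r in (0:ℝ)..s, (derivWithin w (Ici 0) r + η * w r)| ≤ 2 * C / η * |s - 0| := by
    rw [← Real.norm_eq_abs]
    refine intervalIntegral.norm_integral_le_of_norm_le_const fun r hr => ?_
    rw [uIoc_of_le hs.1] at hr
    rw [eq_neg_of_add_eq_zero_left (h.2.2 r hr.1.le), norm_neg]
    exact h.abs_memory_le_div hη hC hηC ⟨hr.1.le, hr.2.trans hs.2⟩
  rw [intervalIntegral.integral_add hw' (hw.const_mul η), hftc,
    intervalIntegral.integral_const_mul, sub_zero, abs_of_nonneg hs.1] at hbound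
  have h1 : 2 * C / η * s ≤ 2 * C * T / η := by
    rw [mul_div_right_comm (2 * C)]
    exact mul_le_mul_of_nonneg_left hs.2 (by positivity)
  calc |η * (∫ r in (0:ℝ)..s, w r) - 1|
      = |(w s - 1 + η * ∫ r in (0:ℝ)..s, w r) - w s| := by ring_nf
    _ ≤ |w s - 1 + η * ∫ r in (0:ℝ)..s, w r| + |w s| := abs_sub _ _
    _ ≤ |w s| + 2 * C * T / η := by linarith

theorem integral_mul_abs_le (h : IsMemorySol M η w) (hη : 0 < η)
    (hC : ∀ s ∈ Icc 0 T, |M s| ≤ C) (hηC : 2 * C * T ≤ η) {s : ℝ} (hs : s ∈ Icc 0 T) :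
    ∫ r in (0:ℝ)..s, r * |w r| ≤ (1 + 2 * C * T ^ 2) / η ^ 2 := by
  have hC0 : 0 ≤ C := (abs_nonneg _).trans (hC s hs)
  have hT : 0 ≤ T := hs.1.trans hs.2
  have h1 : ∫ r in (0:ℝ)..s, r * |w r|
      ≤ ∫ r in (0:ℝ)..s, (r * Real.exp (-(η * r)) + T * (2 * C / η ^ 2)) := by
    refine intervalIntegral.integral_mono_on hs.1
      (ContinuousOn.intervalIntegrable_of_Icc hs.1
        (continuousOn_id.mul (h.continuousOn_Icc s).abs))
      (Continuous.intervalIntegrable (by fun_prop) _ _) fun r hr => ?_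
    have hrT : r ≤ T := hr.2.trans hs.2
    have h2 := mul_le_mul_of_nonneg_left (h.abs_le hη hC hηC ⟨hr.1, hrT⟩) hr.1
    have h3 : r * (2 * C / η ^ 2) ≤ T * (2 * C / η ^ 2) := by gcongr
    linarith
  rw [intervalIntegral.integral_add (Continuous.intervalIntegrable (by fun_prop) _ _)
    (by simp), intervalIntegral.integral_const] at h1
  have h2 := integral_mul_exp_neg_mul_le hη hs.1
  have h3 : s * (T * (2 * C / η ^ 2)) ≤ T * (T * (2 * C / η ^ 2)) :=
    mul_le_mul_of_nonneg_right hs.2 (by positivity)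
  simp only [sub_zero, smul_eq_mul] at h1
  have h4 : (1 + 2 * C * T ^ 2) / η ^ 2 = 1 / η ^ 2 + T * (T * (2 * C / η ^ 2)) := by ring
  linarith

/-- The memory term is `M / η` up to an initial layer and a term of order `η⁻²`. -/
theorem abs_mul_memory_sub_le (h : IsMemorySol M η w) (hη : 1 ≤ η)
    (hMc : ContinuousOn M (Icc 0 T)) {L : NNReal} (hL : LipschitzOnWith L M (Icc 0 T))
    (hC : ∀ s ∈ Icc 0 T, |M s| ≤ C) (hηC : 2 * C * T ≤ η) {s : ℝ} (hs : s ∈ Icc 0 T) :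
    |η * (∫ r in (0:ℝ)..s, M (s - r) * w r) - M s| ≤
      C * Real.exp (-(η * s))
        + (L * (1 + 2 * C * T ^ 2) + 2 * C ^ 2 * T + 2 * C ^ 2) / η := by
  have hη0 : 0 < η := by linarith
  have hC0 : 0 ≤ C := (abs_nonneg _).trans (hC s hs)
  have hwc := h.continuousOn_Icc s
  have hMw : IntervalIntegrable (fun r => M (s - r) * w r) volume 0 s := by
    refine ContinuousOn.intervalIntegrable_of_Icc hs.1 (ContinuousOn.mul ?_ hwc)
    exact hMc.comp (by fun_prop) fun r hr =>
      ⟨by linarith [hr.2], by linarith [hr.1, hs.2]⟩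
  have hcw : IntervalIntegrable (fun r => M s * w r) volume 0 s :=
    (ContinuousOn.intervalIntegrable_of_Icc hs.1 hwc).const_mul _
  have h1 : |∫ r in (0:ℝ)..s, (M (s - r) * w r - M s * w r)|
      ≤ ∫ r in (0:ℝ)..s, (L : ℝ) * (r * |w r|) := by
    rw [← Real.norm_eq_abs]
    refine intervalIntegral.norm_integral_le_of_norm_le hs.1
      (Filter.Eventually.of_forall fun r hr => ?_)
      ((ContinuousOn.intervalIntegrable_of_Icc hs.1
        (continuousOn_id.mul hwc.abs)).const_mul _)
    have h2 := hL.dist_le_mul (s - r) ⟨by linarith [hr.2], by linarith [hr.1, hs.2]⟩ s hs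
    rw [Real.dist_eq, Real.dist_eq, show s - r - s = -r by ring, abs_neg,
      abs_of_pos hr.1] at h2
    rw [← sub_mul, norm_mul, Real.norm_eq_abs, Real.norm_eq_abs, ← mul_assoc]
    exact mul_le_mul_of_nonneg_right h2 (abs_nonneg _)
  rw [intervalIntegral.integral_sub hMw hcw, intervalIntegral.integral_const_mul,
    intervalIntegral.integral_const_mul] at h1
  have h2 := h1.trans (mul_le_mul_of_nonneg_left (h.integral_mul_abs_le hη0 hC hηC hs) L.coe_nonneg)
  have h3 := mul_le_mul (hC s hs) (h.abs_mul_integral_sub_one_le hη0 hC hηC hs)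
    (abs_nonneg _) hC0
  have h4 := mul_le_mul_of_nonneg_left (h.abs_le hη0 hC hηC hs) hC0
  have h5 : 2 * C / η ^ 2 ≤ 2 * C / η :=
    div_le_div_of_nonneg_left (by positivity) hη0 (by nlinarith)
  have h6 := mul_le_mul_of_nonneg_left h5 hC0
  rw [← abs_mul] at h3
  have h7 := mul_le_mul_of_nonneg_left h2 hη0.le
  rw [← abs_of_pos hη0, ← abs_mul, abs_of_pos hη0] at h7
  have h8 : η * (L * ((1 + 2 * C * T ^ 2) / η ^ 2)) = L * (1 + 2 * C * T ^ 2) / η := by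
    field_simp
  rw [h8] at h7
  calc |η * (∫ r in (0:ℝ)..s, M (s - r) * w r) - M s|
      = |η * ((∫ r in (0:ℝ)..s, M (s - r) * w r) - M s * ∫ r in (0:ℝ)..s, w r)
          + M s * (η * (∫ r in (0:ℝ)..s, w r) - 1)| := by ring_nf
    _ ≤ _ := abs_add_le _ _
    _ ≤ L * (1 + 2 * C * T ^ 2) / η + C * (|w s| + 2 * C * T / η) := add_le_add h7 h3
    _ ≤ L * (1 + 2 * C * T ^ 2) / η + C * Real.exp (-(η * s)) + C * (2 * C / η)
          + C * (2 * C * T / η) := by linarith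
    _ = _ := by ring

theorem abs_sq_mul_add_le (h : IsMemorySol M η w) (hη : 1 ≤ η)
    (hMd : ∀ s ∈ Ioo 0 T, DifferentiableAt ℝ M s) {L : NNReal}
    (hL : LipschitzOnWith L M (Icc 0 T))
    (hC : ∀ s ∈ Icc 0 T, |M s| ≤ C) (hηC : 2 * C * T ≤ η) {s : ℝ} (hs : s ∈ Icc 0 T) :
    |η ^ 2 * w s + M s| ≤ (η ^ 2 + C + C * η * s) * Real.exp (-(η * s))
      + (L * (1 + 2 * C * T ^ 2) + 2 * C ^ 2 * T + 2 * C ^ 2 + L) / η := by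
  have hη0 : 0 < η := by linarith
  have hT : 0 ≤ T := hs.1.trans hs.2
  have hC0 : 0 ≤ C := (abs_nonneg _).trans (hC s hs)
  have hmain := abs_le_of_abs_deriv_add_mul_le (z := fun x => η ^ 2 * w x + M x)
    (z' := fun x => η ^ 2 * derivWithin w (Ici 0) x + deriv M x) (A := C)
    (B := L * (1 + 2 * C * T ^ 2) + 2 * C ^ 2 * T + 2 * C ^ 2 + L) hη0 (by positivity)
    ((continuousOn_const.mul (h.continuousOn_Icc T)).add hL.continuousOn)
    (fun x hx => ((h.hasDerivAt hx.1).const_mul _).add (hMd x hx).hasDerivAt)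
    (fun x hx => by
      have h1 := h.2.2 x hx.1.le
      have h2 := h.abs_mul_memory_sub_le hη hL.continuousOn hL hC hηC (Ioo_subset_Icc_self hx)
      have h3 : |deriv M x| ≤ L :=
        norm_deriv_le_of_lipschitzOn (Icc_mem_nhds hx.1 hx.2) hL
      have h4 := mul_le_mul_of_nonneg_left h2 hη0.le
      rw [← abs_of_pos hη0, ← abs_mul, abs_of_pos hη0, mul_add, mul_div_cancel₀ _ hη0.ne'] at h4
      calc |η ^ 2 * derivWithin w (Ici 0) x + deriv M x + η * (η ^ 2 * w x + M x)|
          = |deriv M x - η * (η * (∫ r in (0:ℝ)..x, M (x - r) * w r) - M x)| := by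
            congr 1
            linear_combination η ^ 2 * h1
        _ ≤ |deriv M x| + |η * (η * (∫ r in (0:ℝ)..x, M (x - r) * w r) - M x)| := abs_sub _ _
        _ ≤ _ := by linarith) hs
  refine hmain.trans ?_
  have h0 : |η ^ 2 * w 0 + M 0| ≤ η ^ 2 + C := by
    rw [h.2.1, mul_one]
    refine (abs_add_le _ _).trans (add_le_add (abs_of_nonneg (by positivity)).le ?_)
    exact hC 0 ⟨le_rfl, hT⟩
  gcongr

end IsMemorySol

/-- high-frequency limit.  Let `M ∈ C^∞([0,∞))` and, for each `η > 0`, let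
`w η` be the `C¹` solution of the memory ODE with parameter `η`.  Then for every fixed `t > 0`,
`η² w_η(t) → −M(t)` as `η → +∞`. -/
theorem memory_ode_high_frequency_limit
    (M : ℝ → ℝ) (hM : ContDiffOn ℝ (⊤ : ℕ∞) M (Set.Ici 0))
    (w : ℝ → ℝ → ℝ) (hw : ∀ η : ℝ, 0 < η → IsMemorySol M η (w η))
    (t : ℝ) (ht : 0 < t) :
    Filter.Tendsto (fun η : ℝ => η ^ 2 * w η t) Filter.atTop (nhds (-M t)) := by
  have hM1 : ContDiffOn ℝ (⊤ : ℕ∞) M (Icc 0 t) := hM.mono Icc_subset_Ici_self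
  obtain ⟨L, hL⟩ := hM1.exists_lipschitzOnWith (by simp) (convex_Icc 0 t) isCompact_Icc
  obtain ⟨C, hC⟩ := isCompact_Icc.exists_bound_of_continuousOn hM1.continuousOn
  have hMd : ∀ s ∈ Ioo 0 t, DifferentiableAt ℝ M s := fun s hs =>
    (hM.differentiableOn (by simp) s hs.1.le).differentiableAt (Ici_mem_nhds hs.1)
  set B := L * (1 + 2 * C * t ^ 2) + 2 * C ^ 2 * t + 2 * C ^ 2 + L
  have hlim : Filter.Tendsto
      (fun η : ℝ => (η ^ 2 + C + C * η * t) * Real.exp (-(η * t)) + B / η)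
      Filter.atTop (nhds 0) := by
    have hx : Filter.Tendsto (fun η : ℝ => η * t) Filter.atTop Filter.atTop :=
      Filter.tendsto_id.atTop_mul_const ht
    have h (n : ℕ) := (Real.tendsto_pow_mul_exp_neg_atTop_nhds_zero n).comp hx
    have hsum := ((((h 2).const_mul (1 / t ^ 2)).add ((h 0).const_mul C)).add
      ((h 1).const_mul C)).add (Filter.tendsto_id.const_div_atTop B)
    simp only [mul_zero, add_zero] at hsum
    refine hsum.congr fun η => ?_
    simp only [Function.comp_apply, id]
    field_simp
  rw [tendsto_iff_norm_sub_tendsto_zero]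
  refine squeeze_zero' (Filter.Eventually.of_forall fun _ => norm_nonneg _) ?_ hlim
  filter_upwards [Filter.eventually_ge_atTop 1, Filter.eventually_ge_atTop (2 * C * t)]
    with η hη hηC
  rw [sub_neg_eq_add]
  exact (hw η (by linarith)).abs_sq_mul_add_le hη hMd hL hC hηC ⟨ht.le, le_rfl⟩
end
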